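/- Let S be a complete separable metric space, let f ∈ F₁(a,b) be admissible, let Γ ⊂ C_b(S) be admissible and strictly admissible, and let Q, P be Borel probability measures on S. For L > 0 let Γ_L = {L·g : g ∈ Γ}. Then each Γ_L is strictly admissible, and lim_{L→∞} D_f^{Γ_L}(Q‖P) = D_f(Q‖P). -/

import Mathlib

open MeasureTheory Filter Set Topology ENNReal
open scoped Classical

noncomputable section

/-- The set of bounded measurable real-valued functions on `Ω`. -/
def Mb (Ω : Type*) [MeasurableSpace Ω] : Set (Ω → ℝ) :=
  {g | Measurable g ∧ ∃ C : ℝ, ∀ x, |g x| ≤ C}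

/-- The set of bounded continuous real-valued functions on `S`. -/
def Cb (S : Type*) [TopologicalSpace S] : Set (S → ℝ) :=
  {g | Continuous g ∧ ∃ C : ℝ, ∀ x, |g x| ≤ C}

/-- The positive part of an extended real number, as an element of `ℝ≥0∞`. -/
def posE (x : EReal) : ℝ≥0∞ := if x = ⊤ then ⊤ else ENNReal.ofReal x.toReal

/-- The extended-real-valued integral of an `EReal`-valued function, defined as the
difference of the lower integrals of the positive and negative parts, with the
convention `∞ - ∞ = -∞`. -/
def eIntegral {Ω : Type*} [MeasurableSpace Ω] (P : Measure Ω) (h : Ω → EReal) : EReal :=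
  ((∫⁻ x, posE (h x) ∂P : ℝ≥0∞) : EReal) - ((∫⁻ x, posE (-(h x)) ∂P : ℝ≥0∞) : EReal)

/-- The Legendre transform `f*(y) = sup_x {x*y - f(x)}` of `f : ℝ → (-∞,∞]`. -/
def fstar (f : ℝ → EReal) (y : ℝ) : EReal := ⨆ x : ℝ, (((x * y : ℝ) : EReal) - f x)

/-- `f : ℝ → (-∞,∞]` is (the convex LSC extension of) an element of `F₁(a,b)`:
convex, lower semicontinuous, never `-∞`, finite exactly on the interval `(a,b)`
(with `+∞` strictly outside `[a,b]`), and `f(1) = 0` with `a < 1 < b`. -/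
structure IsF1 (a b : EReal) (f : ℝ → EReal) : Prop where
  a_lt_one : a < ((1 : ℝ) : EReal)
  one_lt_b : ((1 : ℝ) : EReal) < b
  convex : ∀ x y t : ℝ, 0 < t → t < 1 →
    f (t * x + (1 - t) * y) ≤ ((t : ℝ) : EReal) * f x + (((1 - t : ℝ)) : EReal) * f y
  lsc : LowerSemicontinuous f
  ne_bot : ∀ x, f x ≠ ⊥
  finite_on : ∀ x : ℝ, a < (x : EReal) → (x : EReal) < b → f x ≠ ⊤
  top_outside : ∀ x : ℝ, ((x : EReal) < a ∨ b < (x : EReal)) → f x = ⊤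
  at_one : f 1 = 0

/-- `Λ_f^P[g] = inf_{ν ∈ ℝ} {ν + E_P[f*(g - ν)]}`. -/
def LambdaF {Ω : Type*} [MeasurableSpace Ω] (f : ℝ → EReal) (P : Measure Ω) (g : Ω → ℝ) :
    EReal :=
  ⨅ ν : ℝ, ((ν : EReal) + eIntegral P (fun x => fstar f (g x - ν)))

/-- The classical `f`-divergence `D_f(Q‖P) = E_P[f(dQ/dP)]` if `Q ≪ P`, else `∞`. -/
def fDivE {Ω : Type*} [MeasurableSpace Ω] (f : ℝ → EReal) (Q P : Measure Ω) : EReal :=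
  if Q ≪ P then eIntegral P (fun x => f ((Q.rnDeriv P x).toReal)) else ⊤

/-- The `(f,Γ)`-divergence `D_f^Γ(Q‖P) = sup_{g ∈ Γ} {E_Q[g] - Λ_f^P[g]}`. -/
def fGammaDiv {Ω : Type*} [MeasurableSpace Ω] (f : ℝ → EReal) (Γ : Set (Ω → ℝ))
    (Q P : Measure Ω) : EReal :=
  ⨆ g ∈ Γ, (((∫ x, g x ∂Q : ℝ) : EReal) - LambdaF f P g)

/-- The `Γ`-IPM `W^Γ(Q,P) = sup_{g ∈ Γ} {E_Q[g] - E_P[g]}`. -/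
def ipmW {Ω : Type*} [MeasurableSpace Ω] (Γ : Set (Ω → ℝ)) (Q P : Measure Ω) : EReal :=
  ⨆ g ∈ Γ, (((∫ x, g x ∂Q : ℝ) : EReal) - ((∫ x, g x ∂P : ℝ) : EReal))


/-- Integration of a function against a finite signed measure, via the Jordan
decomposition. -/
def signedIntegral {S : Type*} [MeasurableSpace S] (μ : MeasureTheory.SignedMeasure S)
    (g : S → ℝ) : ℝ :=
  (∫ x, g x ∂μ.toJordanDecomposition.posPart) - ∫ x, g x ∂μ.toJordanDecomposition.negPart

/-- The weak topology on real-valued functions on `S` generated by the maps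
`g ↦ ∫ g dμ` for all finite signed (Borel) measures `μ` on `S`. -/
def weakTop (S : Type*) [MeasurableSpace S] : TopologicalSpace (S → ℝ) :=
  ⨅ μ : MeasureTheory.SignedMeasure S,
    TopologicalSpace.induced (fun g => signedIntegral μ g) inferInstance

/-- A set `Ψ` of functions is `P(S)`-determining: if two probability measures give the
same integral to every `ψ ∈ Ψ`, then they are equal. -/
def Determining {S : Type*} [MeasurableSpace S] (Ψ : Set (S → ℝ)) : Prop :=
  ∀ Q P : Measure S, IsProbabilityMeasure Q → IsProbabilityMeasure P →
    (∀ ψ ∈ Ψ, (∫ x, ψ x ∂Q) = ∫ x, ψ x ∂P) → Q = P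

/-- `Γ ⊆ C_b(S)` is admissible: it contains `0`, is convex, and is closed in `C_b(S)` for
the weak topology generated by the finite signed measures. -/
def AdmissibleGamma {S : Type*} [TopologicalSpace S] [MeasurableSpace S]
    (Γ : Set (S → ℝ)) : Prop :=
  (fun _ => (0 : ℝ)) ∈ Γ ∧ Convex ℝ Γ ∧ Γ ⊆ Cb S ∧
    ∀ g ∈ Cb S, g ∈ @closure _ (weakTop S) Γ → g ∈ Γ

/-- `Γ` is strictly admissible: there is a `P(S)`-determining set `Ψ ⊆ C_b(S)` such that
for all `ψ ∈ Ψ` there are `c ∈ ℝ` and `ε > 0` with `c ± εψ ∈ Γ`. -/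
def StrictlyAdmissibleGamma {S : Type*} [TopologicalSpace S] [MeasurableSpace S]
    (Γ : Set (S → ℝ)) : Prop :=
  ∃ Ψ : Set (S → ℝ), Ψ ⊆ Cb S ∧ Determining Ψ ∧
    ∀ ψ ∈ Ψ, ∃ c ε : ℝ, 0 < ε ∧
      (fun x => c + ε * ψ x) ∈ Γ ∧ (fun x => c - ε * ψ x) ∈ Γ

/-- `f` is admissible: `f*` is finite everywhere and `lim_{y → -∞} f*(y) < ∞`. -/
def AdmissibleF (f : ℝ → EReal) : Prop :=
  (∀ y : ℝ, fstar f y ≠ ⊤) ∧ ∃ M : ℝ, ∀ᶠ y in Filter.atBot, fstar f y ≤ (M : EReal)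

/-- `f` is strictly convex at `1`: `f` is not affine on any neighborhood of `1`. -/
def StrictlyConvexAtOne (f : ℝ → EReal) : Prop :=
  ∀ ε : ℝ, 0 < ε → ¬ ∃ m q : ℝ, ∀ x : ℝ, |x - 1| < ε → f x = ((m * x + q : ℝ) : EReal)

/-- `f` is strictly convex on the interval `(a,b)` (with `a, b ∈ [-∞,∞]`). -/
def StrictConvexOnAB (a b : EReal) (f : ℝ → EReal) : Prop :=
  ∀ x y t : ℝ, a < (x : EReal) → (x : EReal) < b → a < (y : EReal) → (y : EReal) < b →
    x ≠ y → 0 < t → t < 1 →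
    f (t * x + (1 - t) * y) < ((t : ℝ) : EReal) * f x + (((1 - t : ℝ)) : EReal) * f y

end

structure PhiData (f : ℝ → EReal) (φ : ℝ → ℝ) : Prop where
  star : ∀ y, fstar f y = (φ y : EReal)
  cvx : ConvexOn ℝ univ φ
  mono : Monotone φ
  cont : Continuous φ
  young : ∀ x y, ((x * y - φ y : ℝ) : EReal) ≤ f x
  dual : ∀ (x m : ℝ), (m : EReal) < f x → ∃ y, m < x * y - φ y

theorem sub_le_coe_iff (x c : ℝ) (z : EReal) :
    ((x : EReal) - z ≤ (c : EReal)) ↔ (((x - c : ℝ) : EReal) ≤ z) := by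
  induction z using EReal.rec with
  | bot => simp [sub_eq_add_neg]
  | top => simp [sub_eq_add_neg]
  | coe v =>
    rw [← EReal.coe_sub, EReal.coe_le_coe_iff, EReal.coe_le_coe_iff]
    constructor <;> intro h <;> linarith

theorem fstar_le_iff (f : ℝ → EReal) (y c : ℝ) :
    fstar f y ≤ (c : EReal) ↔ ∀ x, ((x * y - c : ℝ) : EReal) ≤ f x := by
  unfold fstar
  rw [iSup_le_iff]
  exact forall_congr' fun x => sub_le_coe_iff _ _ _

theorem epi_dual {a b : EReal} {f : ℝ → EReal} (hf : IsF1 a b f) (c0 : ℝ)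
    (h0 : ∀ x, ((-c0 : ℝ) : EReal) ≤ f x) (x0 m : ℝ) (hm : (m : EReal) < f x0) :
    ∃ y m' : ℝ, m < m' ∧ ∀ x, ((x * y - (x0 * y - m') : ℝ) : EReal) ≤ f x := by
  set E : Set (ℝ × ℝ) := {p | f p.1 ≤ (p.2 : EReal)} with hE
  have hEc : IsClosed E := by
    have := hf.lsc.isClosed_epigraph
    have hc : Continuous (fun p : ℝ × ℝ => (p.1, (p.2 : EReal))) := by
      exact continuous_fst.prodMk (continuous_coe_real_ereal.comp continuous_snd)
    exact this.preimage hc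
  have hEv : Convex ℝ E := by
    rw [convex_iff_forall_pos]
    rintro ⟨x, s⟩ hx ⟨y, u⟩ hy p q hp hq hpq
    have hq' : q = 1 - p := by linarith
    subst hq'
    simp only [hE, mem_ofPred_eq] at hx hy
    have := hf.convex x y p hp (by linarith)
    simp only [hE, mem_ofPred_eq, Prod.smul_mk, Prod.mk_add_mk, smul_eq_mul]
    refine this.trans ?_
    rw [EReal.coe_add, EReal.coe_mul, EReal.coe_mul]
    exact add_le_add (mul_le_mul_of_nonneg_left hx (by exact_mod_cast hp.le))
      (mul_le_mul_of_nonneg_left hy (by exact_mod_cast hq.le))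
  have hnot : (x0, m) ∉ E := by simp [hE, hm]
  obtain ⟨l, u, hl, hu⟩ := geometric_hahn_banach_point_closed hEv hEc hnot
  set α := l (1, 0)
  set β := l (0, 1)
  have hlin : ∀ x s : ℝ, l (x, s) = α * x + β * s := by
    intro x s
    have : ((x, s) : ℝ × ℝ) = x • ((1, 0) : ℝ × ℝ) + s • ((0, 1) : ℝ × ℝ) := by simp
    rw [this, map_add, map_smul, map_smul]; simp [α, β]; ring
  rw [hlin] at hl
  have hu' : ∀ x s : ℝ, f x ≤ (s : EReal) → u < α * x + β * s := by
    intro x s h; rw [← hlin]; exact hu (x, s) h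
  have hβ : 0 ≤ β := by
    by_contra hneg
    push Not at hneg
    have h1 : f 1 ≤ ((max 0 ((u - α) / β) : ℝ) : EReal) := by
      rw [hf.at_one]; exact_mod_cast le_max_left _ _
    have h2 := hu' _ _ h1
    have h3 : β * max 0 ((u - α) / β) ≤ β * ((u - α) / β) :=
      mul_le_mul_of_nonpos_left (le_max_right _ _) hneg.le
    rw [mul_div_cancel₀ _ hneg.ne] at h3
    linarith
  have key : ∀ (y c : ℝ), (∀ x s : ℝ, f x = (s : EReal) → x * y - c ≤ s) →
      ∀ x, ((x * y - c : ℝ) : EReal) ≤ f x := by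
    intro y c h x
    cases hfx : f x with
    | bot => exact absurd hfx (hf.ne_bot x)
    | top => exact le_top
    | coe v => exact_mod_cast h x v hfx
  rcases hβ.eq_or_lt with hβ0 | hβ0
  · -- vertical separation
    rw [← hβ0] at hl hu'
    simp only [zero_mul, add_zero] at hl hu'
    have hpos : 0 < u - α * x0 := by linarith
    obtain ⟨t, ht0, ht⟩ : ∃ t : ℝ, 0 ≤ t ∧ m + 1 ≤ -c0 + t * (u - α * x0) := by
      refine ⟨max 0 ((m + 1 + c0) / (u - α * x0)), le_max_left _ _, ?_⟩
      have := mul_le_mul_of_nonneg_right (le_max_right 0 ((m + 1 + c0) / (u - α * x0))) hpos.le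
      rw [div_mul_cancel₀ _ hpos.ne'] at this
      linarith
    refine ⟨-(t * α), -c0 + t * (u - α * x0), by linarith, key _ _ ?_⟩
    intro x s hs
    have h1 := hu' x s hs.le
    have h2 : -c0 ≤ s := by have := h0 x; rw [hs] at this; exact_mod_cast this
    nlinarith
  · refine ⟨-(α / β), (u - α * x0) / β, ?_, key _ _ ?_⟩
    · rw [lt_div_iff₀ hβ0]; linarith
    · intro x s hs
      have h1 := hu' x s hs.le
      have : x * -(α / β) - (x0 * -(α / β) - (u - α * x0) / β) = (u - α * x) / β := by
        field_simp; ring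
      rw [this, div_le_iff₀ hβ0]; linarith

theorem exists_phi {a b : EReal} {f : ℝ → EReal} (hf : IsF1 a b f) (hfa : AdmissibleF f) :
    ∃ φ : ℝ → ℝ, PhiData f φ := by
  have hstar : ∀ y, ∃ c : ℝ, fstar f y = (c : EReal) := by
    intro y
    cases h : fstar f y with
    | bot =>
      exfalso
      have : fstar f y ≤ ((y - 1 : ℝ) : EReal) := by rw [h]; exact bot_le
      rw [fstar_le_iff] at this
      have := this 1
      rw [hf.at_one] at this
      have : (1 : ℝ) * y - (y - 1) ≤ 0 := by exact_mod_cast this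
      linarith
    | top => exact absurd h (hfa.1 y)
    | coe c => exact ⟨c, rfl⟩
  choose φ hφ using hstar
  have young : ∀ x y, ((x * y - φ y : ℝ) : EReal) ≤ f x := fun x y =>
    (fstar_le_iff f y (φ y)).1 (hφ y).le x
  have le_iff : ∀ y c : ℝ, φ y ≤ c ↔ ∀ x, ((x * y - c : ℝ) : EReal) ≤ f x := by
    intro y c
    rw [← fstar_le_iff, hφ, EReal.coe_le_coe_iff]
  have hcases : ∀ (A : ℝ → ℝ), (∀ x s : ℝ, f x = (s : EReal) → A x ≤ s) →
      ∀ x, ((A x : ℝ) : EReal) ≤ f x := by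
    intro A h x
    cases hfx : f x with
    | bot => exact absurd hfx (hf.ne_bot x)
    | top => exact le_top
    | coe v => exact_mod_cast h x v hfx
  have youngR : ∀ x s y : ℝ, f x = (s : EReal) → x * y - φ y ≤ s := by
    intro x s y h
    have := young x y
    rw [h] at this; exact_mod_cast this
  have hneg : ∀ x s : ℝ, f x = (s : EReal) → 0 ≤ x := by
    intro x s h
    by_contra hx
    push Not at hx
    obtain ⟨M, hM⟩ := hfa.2
    obtain ⟨y, h1, h2⟩ := (hM.and (eventually_lt_atBot ((M + s) / x))).exists
    rw [hφ] at h1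
    have h1 : φ y ≤ M := by exact_mod_cast h1
    have h3 := youngR x s y h
    rw [lt_div_iff_of_neg hx] at h2
    linarith
  have cvx : ConvexOn ℝ univ φ := by
    refine ⟨convex_univ, ?_⟩
    intro y _ z _ p q hp hq hpq
    simp only [smul_eq_mul]
    rw [le_iff]
    apply hcases (fun x => x * (p * y + q * z) - (p * φ y + q * φ z))
    intro x s h
    have h1 := mul_le_mul_of_nonneg_left (youngR x s y h) hp
    have h2 := mul_le_mul_of_nonneg_left (youngR x s z h) hq
    have h3 : p * s + q * s = s := by rw [← add_mul, hpq, one_mul]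
    linarith
  refine ⟨φ, hφ, cvx, ?_, ?_, young, ?_⟩
  · intro y z hyz
    rw [le_iff]
    apply hcases (fun x => x * y - φ z)
    intro x s h
    have h1 := youngR x s z h
    have h2 := mul_le_mul_of_nonneg_left hyz (hneg x s h)
    linarith
  · exact cvx.locallyLipschitz.continuous
  · intro x m hm
    obtain ⟨y, m', h1, h2⟩ := epi_dual hf (φ 0) (fun x => by simpa using young x 0) x m hm
    refine ⟨y, ?_⟩
    have := (le_iff y (x * y - m')).2 h2
    linarith

theorem posE_coe (x : ℝ) : posE (x : EReal) = ENNReal.ofReal x := by simp [posE]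

theorem eIntegral_coe {Ω : Type*} [MeasurableSpace Ω] (P : Measure Ω) (h : Ω → EReal)
    (k : Ω → ℝ) (hk : Integrable k P) (hh : ∀ᵐ x ∂P, h x = (k x : EReal)) :
    eIntegral P h = ((∫ x, k x ∂P : ℝ) : EReal) := by
  have e1 : ∫⁻ x, posE (h x) ∂P = ∫⁻ x, ENNReal.ofReal (k x) ∂P := by
    apply lintegral_congr_ae
    filter_upwards [hh] with x hx
    rw [hx, posE_coe]
  have e2 : ∫⁻ x, posE (-(h x)) ∂P = ∫⁻ x, ENNReal.ofReal (-(k x)) ∂P := by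
    apply lintegral_congr_ae
    filter_upwards [hh] with x hx
    rw [hx, ← EReal.coe_neg, posE_coe]
  have f1 : ∫⁻ x, ENNReal.ofReal (k x) ∂P ≠ ⊤ := hk.lintegral_lt_top.ne
  have f2 : ∫⁻ x, ENNReal.ofReal (-(k x)) ∂P ≠ ⊤ := hk.neg.lintegral_lt_top.ne
  rw [eIntegral, e1, e2, integral_eq_lintegral_pos_part_sub_lintegral_neg_part hk,
    EReal.coe_sub, EReal.coe_ennreal_toReal f1, EReal.coe_ennreal_toReal f2]

theorem integrable_of_mb {Ω : Type*} [MeasurableSpace Ω] (P : Measure Ω) [IsFiniteMeasure P]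
    {g : Ω → ℝ} (hg : g ∈ Mb Ω) : Integrable g P := by
  obtain ⟨hm, C, hC⟩ := hg
  exact Integrable.of_bound hm.aestronglyMeasurable C (Eventually.of_forall hC)

theorem PhiData.comp_mb {f : ℝ → EReal} {φ : ℝ → ℝ} (H : PhiData f φ)
    {Ω : Type*} [MeasurableSpace Ω] {g : Ω → ℝ} (hg : g ∈ Mb Ω) :
    (fun x => φ (g x)) ∈ Mb Ω := by
  obtain ⟨hm, C, hC⟩ := hg
  refine ⟨H.cont.measurable.comp hm, max |φ (-C)| |φ C|, fun x => ?_⟩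
  have := abs_le.1 (hC x)
  exact abs_le_max_abs_abs (H.mono this.1) (H.mono this.2)

theorem PhiData.eInt {f : ℝ → EReal} {φ : ℝ → ℝ} (H : PhiData f φ)
    {Ω : Type*} [MeasurableSpace Ω] (P : Measure Ω) [IsFiniteMeasure P]
    {g : Ω → ℝ} (hg : g ∈ Mb Ω) :
    eIntegral P (fun x => fstar f (g x)) = ((∫ x, φ (g x) ∂P : ℝ) : EReal) :=
  eIntegral_coe P _ _ (integrable_of_mb P (H.comp_mb hg))
    (Eventually.of_forall fun x => H.star _)

theorem sub_const_mb {Ω : Type*} [MeasurableSpace Ω] {g : Ω → ℝ} (hg : g ∈ Mb Ω) (ν : ℝ) :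
    (fun x => g x - ν) ∈ Mb Ω := by
  obtain ⟨hm, C, hC⟩ := hg
  refine ⟨hm.sub_const ν, C + |ν|, fun x => ?_⟩
  exact (abs_sub _ _).trans (by linarith [hC x])

theorem PhiData.finite_case {f : ℝ → EReal} {φ : ℝ → ℝ} (H : PhiData f φ)
    (hlsc : LowerSemicontinuous f)
    {Ω : Type*} [MeasurableSpace Ω] (P : Measure Ω) [IsProbabilityMeasure P]
    (r : Ω → ℝ) (hr : Measurable r) (hfin : ∫⁻ x, posE (f (r x)) ∂P ≠ ⊤) :
    ∃ k : Ω → ℝ, Integrable k P ∧ (∀ᵐ x ∂P, f (r x) = (k x : EReal)) := by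
  have hfm : Measurable (fun x => f (r x)) := hlsc.measurable.comp hr
  have hpm : Measurable posE := by
    unfold posE
    refine Measurable.ite (measurableSet_singleton ⊤) measurable_const ?_
    exact ENNReal.measurable_ofReal.comp measurable_ereal_toReal
  have hlt := ae_lt_top (hpm.comp hfm) hfin
  have hae : ∀ᵐ x ∂P, f (r x) = (((f (r x)).toReal : ℝ) : EReal) := by
    filter_upwards [hlt] with x hx
    refine (EReal.coe_toReal ?_ ?_).symm
    · intro h
      simp [posE, h] at hx
    · intro h
      have := H.young (r x) 0
      rw [h] at this
      exact EReal.coe_ne_bot _ (le_bot_iff.1 this)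
  refine ⟨fun x => (f (r x)).toReal, ?_, hae⟩
  have hkm : Measurable (fun x => (f (r x)).toReal) := measurable_ereal_toReal.comp hfm
  have hb : Integrable (fun x => max ((f (r x)).toReal) 0) P := by
    refine ⟨(hkm.max measurable_const).aestronglyMeasurable, ?_⟩
    rw [hasFiniteIntegral_iff_ofReal (f := fun x => max ((f (r x)).toReal) 0)
      (Eventually.of_forall fun x => le_max_right _ _)]
    refine lt_of_le_of_lt (le_of_eq ?_) hfin.lt_top
    apply lintegral_congr_ae
    filter_upwards [hae] with x hx
    rw [hx, posE_coe, EReal.toReal_coe]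
    rcases le_total ((f (r x)).toReal) 0 with h | h
    · rw [max_eq_right h, ENNReal.ofReal_of_nonpos h, ENNReal.ofReal_zero]
    · rw [max_eq_left h]
  refine Integrable.mono' (hb.add (integrable_const |φ 0|)) hkm.aestronglyMeasurable ?_
  filter_upwards [hae] with x hx
  have h1 := H.young (r x) 0
  rw [hx] at h1
  have h1 : r x * 0 - φ 0 ≤ (f (r x)).toReal := by exact_mod_cast h1
  simp only [Pi.add_apply, Real.norm_eq_abs]
  have := le_abs_self (φ 0)
  have := le_max_left ((f (r x)).toReal) 0
  have := le_max_right ((f (r x)).toReal) 0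
  have := abs_nonneg (φ 0)
  exact abs_le.2 ⟨by linarith, by linarith⟩

theorem PhiData.neg_part {f : ℝ → EReal} {φ : ℝ → ℝ} (H : PhiData f φ)
    {Ω : Type*} [MeasurableSpace Ω] (P : Measure Ω) [IsProbabilityMeasure P]
    (r : Ω → ℝ) (hfin : ∫⁻ x, posE (f (r x)) ∂P = ⊤) :
    eIntegral P (fun x => f (r x)) = ⊤ := by
  have hb : ∫⁻ x, posE (-(f (r x))) ∂P ≤ ENNReal.ofReal (φ 0) := by
    calc _ ≤ ∫⁻ x, ENNReal.ofReal (φ 0) ∂P := by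
          apply lintegral_mono
          intro x
          have h1 := H.young (r x) 0
          simp only
          cases hx : f (r x) with
          | bot => rw [hx] at h1; exact absurd (le_bot_iff.1 h1) (EReal.coe_ne_bot _)
          | top => simp [posE]
          | coe v =>
            rw [hx] at h1
            have h1 : r x * 0 - φ 0 ≤ v := by exact_mod_cast h1
            rw [← EReal.coe_neg, posE_coe]
            exact ENNReal.ofReal_le_ofReal (by linarith)
      _ = _ := by simp
  have hne : ∫⁻ x, posE (-(f (r x))) ∂P ≠ ⊤ := ne_top_of_le_ne_top ENNReal.ofReal_ne_top hb
  rw [eIntegral, hfin]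
  rw [← EReal.coe_ennreal_toReal hne]
  simp

theorem rn_integrable {Ω : Type*} [MeasurableSpace Ω] (Q P : Measure Ω)
    [IsProbabilityMeasure Q] [IsProbabilityMeasure P] {g : Ω → ℝ} (hg : g ∈ Mb Ω) :
    Integrable (fun x => (Q.rnDeriv P x).toReal * g x) P := by
  obtain ⟨hm, C, hC⟩ := hg
  exact (Measure.integrable_toReal_rnDeriv (μ := Q) (ν := P)).mul_bdd (c := C)
    hm.aestronglyMeasurable (Eventually.of_forall hC)

theorem rn_integral {Ω : Type*} [MeasurableSpace Ω] (Q P : Measure Ω)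
    [IsProbabilityMeasure Q] [IsProbabilityMeasure P] (hQP : Q ≪ P) (g : Ω → ℝ) :
    ∫ x, (Q.rnDeriv P x).toReal * g x ∂P = ∫ x, g x ∂Q := by
  simpa using integral_rnDeriv_smul (f := g) hQP

theorem PhiData.upper {f : ℝ → EReal} {φ : ℝ → ℝ} (H : PhiData f φ)
    (hlsc : LowerSemicontinuous f)
    {Ω : Type*} [MeasurableSpace Ω] (Q P : Measure Ω)
    [IsProbabilityMeasure Q] [IsProbabilityMeasure P] {g : Ω → ℝ} (hg : g ∈ Mb Ω) :
    ((∫ x, g x ∂Q : ℝ) : EReal) - LambdaF f P g ≤ fDivE f Q P := by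
  unfold fDivE
  split_ifs with hQP
  swap
  · exact le_top
  have hrm : Measurable (fun x => (Q.rnDeriv P x).toReal) :=
    (Measure.measurable_rnDeriv Q P).ennreal_toReal
  by_cases hfin : ∫⁻ x, posE (f ((Q.rnDeriv P x).toReal)) ∂P = ⊤
  · rw [H.neg_part P _ hfin]; exact le_top
  obtain ⟨k, hk, hkf⟩ := H.finite_case hlsc P _ hrm hfin
  rw [eIntegral_coe P _ k hk hkf, sub_le_coe_iff]
  unfold LambdaF
  apply le_iInf
  intro ν
  have hg' := sub_const_mb hg ν
  rw [H.eInt P hg', ← EReal.coe_add, EReal.coe_le_coe_iff]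
  have h1 : ∫ x, ((Q.rnDeriv P x).toReal * (g x - ν) - φ (g x - ν)) ∂P ≤ ∫ x, k x ∂P := by
    apply integral_mono_ae ((rn_integrable Q P hg').sub (integrable_of_mb P (H.comp_mb hg'))) hk
    filter_upwards [hkf] with x hx
    have := H.young ((Q.rnDeriv P x).toReal) (g x - ν)
    rw [hx] at this
    exact_mod_cast this
  rw [integral_sub (rn_integrable Q P hg') (integrable_of_mb P (H.comp_mb hg')),
    rn_integral Q P hQP (fun x => g x - ν), integral_sub (integrable_of_mb Q hg)
    (integrable_const _)] at h1
  simp at h1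
  linarith

/-- The greedy maximizers. -/
noncomputable def greedy (φ : ℝ → ℝ) (y : ℕ → ℝ) {Ω : Type*} (r : Ω → ℝ) : ℕ → Ω → ℝ
  | 0 => fun _ => 0
  | n + 1 => fun x => if r x * greedy φ y r n x - φ (greedy φ y r n x) < r x * y n - φ (y n)
      then y n else greedy φ y r n x

theorem greedy_mb (φ : ℝ → ℝ) (hφ : Continuous φ) (y : ℕ → ℝ) {Ω : Type*} [MeasurableSpace Ω]
    (r : Ω → ℝ) (hr : Measurable r) (n : ℕ) : greedy φ y r n ∈ Mb Ω := by
  induction n with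
  | zero => exact ⟨measurable_const, 0, by simp [greedy]⟩
  | succ n ih =>
    obtain ⟨hm, C, hC⟩ := ih
    refine ⟨?_, max |y n| C, fun x => ?_⟩
    · unfold greedy
      refine Measurable.ite (measurableSet_lt ?_ ?_) measurable_const hm
      · exact (hr.mul hm).sub (hφ.measurable.comp hm)
      · exact (hr.mul_const _).sub_const _
    · simp only [greedy]
      split_ifs
      · exact le_max_left _ _
      · exact (hC x).trans (le_max_right _ _)

theorem greedy_step (φ : ℝ → ℝ) (y : ℕ → ℝ) {Ω : Type*} (r : Ω → ℝ) (n : ℕ) (x : Ω) :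
    r x * greedy φ y r (n+1) x - φ (greedy φ y r (n+1) x) =
      max (r x * greedy φ y r n x - φ (greedy φ y r n x)) (r x * y n - φ (y n)) := by
  simp only [greedy]
  split_ifs with h
  · rw [max_eq_right h.le]
  · rw [max_eq_left (not_lt.1 h)]

theorem PhiData.lower {f : ℝ → EReal} {φ : ℝ → ℝ} (H : PhiData f φ)
    (hlsc : LowerSemicontinuous f)
    {Ω : Type*} [MeasurableSpace Ω] (Q P : Measure Ω)
    [IsProbabilityMeasure Q] [IsProbabilityMeasure P] (hQP : Q ≪ P) (c : ℝ)
    (hc : ∀ g ∈ Mb Ω, ∫ x, g x ∂Q ≤ ∫ x, φ (g x) ∂P + c) :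
    fDivE f Q P ≤ (c : EReal) := by
  unfold fDivE
  rw [if_pos hQP]
  set r : Ω → ℝ := fun x => (Q.rnDeriv P x).toReal with hr
  have hrm : Measurable r := (Measure.measurable_rnDeriv Q P).ennreal_toReal
  set y := TopologicalSpace.denseSeq ℝ
  set F : ℕ → Ω → ℝ := fun n x => r x * greedy φ y r n x - φ (greedy φ y r n x) with hF
  have hFm : ∀ x, Monotone (fun n => F n x) := fun x => monotone_nat_of_le_succ fun n => by
    simp only [hF]; rw [greedy_step]; exact le_max_left _ _
  have hF0 : ∀ n x, -φ 0 ≤ F n x := fun n x => by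
    refine le_trans ?_ (hFm x (Nat.zero_le n)); simp [hF, greedy]
  have hgm := fun n => greedy_mb φ H.cont y r hrm n
  have hFi : ∀ n, Integrable (F n) P := fun n =>
    (rn_integrable Q P (hgm n)).sub (integrable_of_mb P (H.comp_mb (hgm n)))
  have hFc : ∀ n, ∫ x, F n x ∂P ≤ c := fun n => by
    have : ∫ x, F n x ∂P = _ :=
      integral_sub (rn_integrable Q P (hgm n)) (integrable_of_mb P (H.comp_mb (hgm n)))
    rw [this, rn_integral Q P hQP]
    linarith [hc _ (hgm n)]
  -- the pointwise bound
  have hbound : ∀ x, ∀ m : ℝ, (m : EReal) < f (r x) → ∃ n, m < F n x := by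
    intro x m hm
    obtain ⟨z, hz⟩ := H.dual _ _ hm
    have ho : IsOpen {z | m < r x * z - φ z} :=
      isOpen_lt continuous_const ((continuous_const.mul continuous_id).sub H.cont)
    obtain ⟨n, hn⟩ := (TopologicalSpace.denseRange_denseSeq ℝ).exists_mem_open ho ⟨z, hz⟩
    refine ⟨n + 1, ?_⟩
    simp only [hF]; rw [greedy_step]
    exact lt_of_lt_of_le hn (le_max_right _ _)
  have hL : ∀ n, ∫⁻ x, ENNReal.ofReal (F n x + φ 0) ∂P ≤ ENNReal.ofReal (c + φ 0) := by
    intro n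
    rw [← ofReal_integral_eq_lintegral_ofReal (f := fun x => F n x + φ 0) ((hFi n).add (integrable_const _))
      (Eventually.of_forall fun x => by have := hF0 n x; simp only [Pi.zero_apply]; linarith)]
    apply ENNReal.ofReal_le_ofReal
    rw [integral_add (hFi n) (integrable_const _)]
    simp; exact hFc n
  have hFmeas : ∀ n, Measurable (F n) := fun n =>
    (hrm.mul (hgm n).1).sub (H.cont.measurable.comp (hgm n).1)
  have hsup : ∫⁻ x, ⨆ n, ENNReal.ofReal (F n x + φ 0) ∂P ≤ ENNReal.ofReal (c + φ 0) := by
    rw [lintegral_iSup]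
    · exact iSup_le hL
    · intro n; exact ((hFmeas n).add_const _).ennreal_ofReal
    · intro n m hnm x
      exact ENNReal.ofReal_le_ofReal (by linarith [hFm x hnm])
  have hptw : ∀ x, posE (f (r x) + ((φ 0 : ℝ) : EReal)) ≤ ⨆ n, ENNReal.ofReal (F n x + φ 0) := by
    intro x
    apply le_of_forall_lt
    intro q hq
    have hqt : q ≠ ⊤ := ne_top_of_lt hq
    have hh : ((q.toReal - φ 0 : ℝ) : EReal) < f (r x) := by
      cases hx : f (r x) with
      | bot => rw [hx] at hq; simp [posE] at hq
      | top => exact EReal.coe_lt_top _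
      | coe v =>
        rw [hx, ← EReal.coe_add, posE_coe, ENNReal.lt_ofReal_iff_toReal_lt hqt] at hq
        rw [EReal.coe_lt_coe_iff]; linarith
    obtain ⟨n, hn⟩ := hbound x _ hh
    refine lt_of_lt_of_le ?_ (le_iSup _ n)
    rw [ENNReal.lt_ofReal_iff_toReal_lt hqt]; linarith
  have hfin2 := (lintegral_mono hptw).trans hsup
  have hφ0 : 0 ≤ c + φ 0 := by
    have := (hFc 0)
    simp [hF, greedy] at this
    linarith
  have hfin : ∫⁻ x, posE (f (r x)) ∂P ≠ ⊤ := by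
    have : ∫⁻ x, posE (f (r x)) ∂P ≤
        ∫⁻ x, (posE (f (r x) + ((φ 0 : ℝ) : EReal)) + ENNReal.ofReal (-φ 0)) ∂P := by
      apply lintegral_mono
      intro x
      simp only
      cases hx : f (r x) with
      | bot => simp [posE]
      | top => simp [posE]
      | coe v =>
        rw [← EReal.coe_add, posE_coe, posE_coe]
        refine le_trans (ENNReal.ofReal_le_ofReal ?_) ENNReal.ofReal_add_le
        linarith
    rw [lintegral_add_right _ measurable_const] at this
    refine ne_top_of_le_ne_top ?_ this
    refine ENNReal.add_ne_top.2 ⟨ne_top_of_le_ne_top ENNReal.ofReal_ne_top hfin2, ?_⟩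
    simp
  obtain ⟨k, hk, hkf⟩ := H.finite_case hlsc P r hrm hfin
  rw [eIntegral_coe P _ k hk hkf, EReal.coe_le_coe_iff]
  have h3 : ∫⁻ x, ENNReal.ofReal (k x + φ 0) ∂P ≤ ENNReal.ofReal (c + φ 0) := by
    refine le_trans (le_of_eq ?_) hfin2
    apply lintegral_congr_ae
    filter_upwards [hkf] with x hx
    rw [hx, ← EReal.coe_add, posE_coe]
  rw [← ofReal_integral_eq_lintegral_ofReal (f := fun x => k x + φ 0) (hk.add (integrable_const _)),
    ENNReal.ofReal_le_ofReal_iff hφ0, integral_add hk (integrable_const _)] at h3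
  · simp at h3; exact h3
  · filter_upwards [hkf] with x hx
    have := H.young (r x) 0
    rw [hx] at this
    have : r x * 0 - φ 0 ≤ k x := by exact_mod_cast this
    simp only [Pi.zero_apply]; linarith

theorem hb_convex {E : Type*} [AddCommGroup E] [Module ℝ E] (J : E → ℝ)
    (hJ : ∀ x y : E, ∀ p q : ℝ, 0 < p → 0 < q → p + q = 1 →
      J (p • x + q • y) ≤ p * J x + q * J y) (h0 : 0 ≤ J 0)
    (V : Submodule ℝ E) (q : E →ₗ[ℝ] ℝ) (hq : ∀ x ∈ V, q x ≤ J x) :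
    ∃ l : E →ₗ[ℝ] ℝ, (∀ x ∈ V, l x = q x) ∧ ∀ x, l x ≤ J x := by
  set N : E → ℝ := fun x => ⨅ t : Ioi (0 : ℝ), J ((t : ℝ) • x) / t with hN
  have hcomb : ∀ x y : E, ∀ t s : ℝ, 0 < t → 0 < s →
      J ((t * s / (t + s)) • (x + y)) / (t * s / (t + s)) ≤ J (t • x) / t + J (s • y) / s := by
    intro x y t s ht hs
    have := hJ (t • x) (s • y) (s / (t + s)) (t / (t + s)) (by positivity) (by positivity)
      (by field_simp; ring)
    have e : (s / (t + s)) • t • x + (t / (t + s)) • s • y = (t * s / (t + s)) • (x + y) := by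
      rw [smul_smul, smul_smul, smul_add]
      congr 2 <;> ring
    rw [e] at this
    rw [div_le_iff₀ (by positivity)]
    refine this.trans (le_of_eq ?_)
    field_simp
  have hlow : ∀ x : E, ∀ t : ℝ, 0 < t → -J (-x) ≤ J (t • x) / t := by
    intro x t ht
    have := hcomb x (-x) t 1 ht one_pos
    simp only [add_neg_cancel, smul_zero, one_smul, div_one] at this
    have h2 : 0 ≤ J 0 / (t * 1 / (t + 1)) := by positivity
    linarith
  have hNle : ∀ x : E, ∀ t : ℝ, 0 < t → N x ≤ J (t • x) / t := by
    intro x t ht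
    refine ciInf_le (f := fun t : Ioi (0 : ℝ) => J ((t : ℝ) • x) / t) ⟨-J (-x), ?_⟩ ⟨t, ht⟩
    rintro _ ⟨s, rfl⟩
    exact hlow x s s.2
  have : Nonempty (Ioi (0 : ℝ)) := ⟨⟨1, Set.mem_Ioi.2 one_pos⟩⟩
  have hleN : ∀ x : E, ∀ b : ℝ, (∀ t : ℝ, 0 < t → b ≤ J (t • x) / t) → b ≤ N x :=
    fun x b h => le_ciInf fun t => h t t.2
  obtain ⟨l, hl1, hl2⟩ := exists_extension_of_le_sublinear (⟨V, q.domRestrict V⟩ : E →ₗ.[ℝ] ℝ) N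
    (by
      intro c hc x
      apply le_antisymm
      · rw [mul_comm, ← div_le_iff₀ hc]
        apply hleN
        intro t ht
        have := hNle (c • x) (t / c) (by positivity)
        rw [smul_smul, div_mul_cancel₀ _ hc.ne'] at this
        rw [div_le_iff₀ hc]
        refine this.trans (le_of_eq ?_)
        field_simp
      · apply hleN
        intro t ht
        have := hNle x (t * c) (by positivity)
        rw [smul_smul]
        refine (mul_le_mul_of_nonneg_left this hc.le).trans (le_of_eq ?_)
        field_simp)
    (by
      intro x y
      have : ∀ t : ℝ, 0 < t → N (x + y) - J (t • x) / t ≤ N y := by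
        intro t ht
        apply hleN
        intro s hs
        have h1 := hcomb x y t s ht hs
        have h2 := hNle (x + y) (t * s / (t + s)) (by positivity)
        linarith
      have : N (x + y) - N y ≤ N x := by
        apply hleN
        intro t ht
        linarith [this t ht]
      linarith)
    (by
      rintro ⟨x, hx⟩
      apply hleN
      intro t ht
      have h1 := hq (t • x) (V.smul_mem t hx)
      rw [map_smul, smul_eq_mul] at h1
      rw [le_div_iff₀ ht]
      calc _ = t * q x := mul_comm _ _
        _ ≤ _ := h1)
  refine ⟨l, fun x hx => hl1 ⟨x, hx⟩, fun x => (hl2 x).trans ?_⟩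
  simpa using hNle x 1 one_pos

/-- Bounded measurable functions as a submodule. -/
def MbS (Ω : Type*) [MeasurableSpace Ω] : Submodule ℝ (Ω → ℝ) where
  carrier := Mb Ω
  zero_mem' := ⟨measurable_const, 0, by simp⟩
  add_mem' := by
    rintro g h ⟨hm, C, hC⟩ ⟨hm', C', hC'⟩
    exact ⟨hm.add hm', C + C', fun x => (abs_add_le _ _).trans (add_le_add (hC x) (hC' x))⟩
  smul_mem' := by
    rintro c g ⟨hm, C, hC⟩
    refine ⟨hm.const_smul c, |c| * C, fun x => ?_⟩
    simp only [Pi.smul_apply, smul_eq_mul, abs_mul]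
    exact mul_le_mul_of_nonneg_left (hC x) (abs_nonneg c)

theorem PhiData.extend {f : ℝ → EReal} {φ : ℝ → ℝ} (H : PhiData f φ)
    {Ω : Type*} [MeasurableSpace Ω] (Q P : Measure Ω)
    [IsProbabilityMeasure Q] [IsProbabilityMeasure P] (c : ℝ)
    (V : Submodule ℝ (Ω → ℝ))
    (hV : ∀ g ∈ V, ∫ x, g x ∂Q ≤ ∫ x, φ (g x) ∂P + c) :
    ∃ l : MbS Ω →ₗ[ℝ] ℝ, (∀ g : MbS Ω, g.1 ∈ V → l g = ∫ x, g.1 x ∂Q) ∧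
      ∀ g : MbS Ω, l g ≤ ∫ x, φ (g.1 x) ∂P + c := by
  have hi : ∀ g : MbS Ω, Integrable (fun x => φ (g.1 x)) P := fun g =>
    integrable_of_mb P (H.comp_mb g.2)
  let q : MbS Ω →ₗ[ℝ] ℝ :=
    { toFun := fun g => ∫ x, g.1 x ∂Q
      map_add' := fun g h => integral_add (integrable_of_mb Q g.2) (integrable_of_mb Q h.2)
      map_smul' := fun a g => integral_const_mul a _ }
  apply hb_convex (fun g : MbS Ω => ∫ x, φ (g.1 x) ∂P + c) ?_ ?_
    (V.comap (MbS Ω).subtype) q (fun g hg => hV _ hg)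
  · intro g h a b ha hb hab
    have : ∫ x, φ ((a • g + b • h : MbS Ω).1 x) ∂P ≤ ∫ x, (a * φ (g.1 x) + b * φ (h.1 x)) ∂P := by
      apply integral_mono (hi _) (((hi g).const_mul a).add ((hi h).const_mul b))
      intro x
      exact H.cvx.2 (mem_univ _) (mem_univ _) ha.le hb.le hab
    rw [integral_add ((hi g).const_mul a) ((hi h).const_mul b), integral_const_mul,
      integral_const_mul] at this
    have hc : c = a * c + b * c := by rw [← add_mul, hab, one_mul]
    show _ ≤ a * (∫ x, φ (g.1 x) ∂P + c) + b * (∫ x, φ (h.1 x) ∂P + c)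
    linarith
  · have := hV 0 V.zero_mem
    simpa using this

/-- Indicator as an element of `MbS`. -/
noncomputable def indS {Ω : Type*} [MeasurableSpace Ω] (A : Set Ω) (hA : MeasurableSet A) : MbS Ω :=
  ⟨A.indicator (fun _ => 1), measurable_const.indicator hA, 1, fun x => by
    by_cases h : x ∈ A <;> simp [h]⟩

theorem PhiData.measure {f : ℝ → EReal} {φ : ℝ → ℝ} (H : PhiData f φ)
    {Ω : Type*} [MeasurableSpace Ω] (P : Measure Ω) [IsProbabilityMeasure P] (c : ℝ)
    (l : MbS Ω →ₗ[ℝ] ℝ) (hl1 : l (indS univ MeasurableSet.univ) = 1)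
    (hl : ∀ g : MbS Ω, l g ≤ ∫ x, φ (g.1 x) ∂P + c) :
    ∃ η : Measure Ω, IsProbabilityMeasure η ∧ η ≪ P ∧ ∀ g : MbS Ω, l g = ∫ x, g.1 x ∂η := by
  set K := φ 0 + c with hK
  have hK0 : 0 ≤ K := by
    have := hl 0
    simpa using this
  have hnp : ∀ g : MbS Ω, (∀ x, g.1 x ≤ 0) → l g ≤ 0 := by
    intro g hg
    by_contra hneg
    push Not at hneg
    have ht : 0 < (K + 1) / l g := by positivity
    have h1 := hl (((K + 1) / l g) • g)
    rw [map_smul, smul_eq_mul, div_mul_cancel₀ _ hneg.ne'] at h1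
    have h2 : ∫ x, φ ((((K + 1) / l g) • g : MbS Ω).1 x) ∂P ≤ ∫ x, φ 0 ∂P := by
      apply integral_mono (integrable_of_mb P (H.comp_mb (Subtype.prop _))) (integrable_const _)
      intro x
      apply H.mono
      exact mul_nonpos_of_nonneg_of_nonpos ht.le (hg x)
    simp at h2
    simp at h1
    linarith
  have hmono : ∀ g h : MbS Ω, (∀ x, g.1 x ≤ h.1 x) → l g ≤ l h := by
    intro g h hgh
    have := hnp (g - h) (fun x => by simpa using hgh x)
    rw [map_sub] at this; linarith
  have hind0 : ∀ A hA, 0 ≤ l (indS (Ω := Ω) A hA) := by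
    intro A hA
    have := hmono 0 (indS A hA) (fun x => by
      simp only [indS]
      by_cases h : x ∈ A <;> simp [h])
    simpa using this
  have hquant : ∀ A hA, ∀ t : ℝ, 0 < t →
      t * l (indS (Ω := Ω) A hA) ≤ K + (φ t - φ 0) * P.real A := by
    intro A hA t ht
    have h1 := hl (t • indS A hA)
    rw [map_smul, smul_eq_mul] at h1
    have h2 : ∫ x, φ ((t • indS A hA : MbS Ω).1 x) ∂P
        = ∫ x, (φ 0 + A.indicator (fun _ => φ t - φ 0) x) ∂P := by
      congr 1
      ext x
      by_cases h : x ∈ A <;> simp [indS, h]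
    rw [h2, integral_add (integrable_const _) ((integrable_const _).indicator hA),
      integral_indicator_const _ hA] at h1
    simp at h1
    linarith
  have htend : ∀ (B : ℕ → Set Ω) (hB : ∀ n, MeasurableSet (B n)),
      Tendsto (fun n => P.real (B n)) atTop (𝓝 0) →
      Tendsto (fun n => l (indS (B n) (hB n))) atTop (𝓝 0) := by
    intro B hB hPB
    rw [tendsto_order]
    refine ⟨fun a ha => Eventually.of_forall fun n => ha.trans_le (hind0 _ _), fun ε hε => ?_⟩
    have ht : 0 < (K + 1) / ε := by positivity
    have : Tendsto (fun n => K + (φ ((K + 1) / ε) - φ 0) * P.real (B n)) atTop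
        (𝓝 (K + (φ ((K + 1) / ε) - φ 0) * 0)) := (hPB.const_mul _).const_add _
    rw [mul_zero, add_zero] at this
    filter_upwards [this.eventually (gt_mem_nhds (show K < K + 1 by linarith))] with n hn
    have h1 := (hquant (B n) (hB n) _ ht).trans_lt hn
    rw [div_mul_eq_mul_div, div_lt_iff₀ hε] at h1
    exact lt_of_mul_lt_mul_left h1 (by linarith)
  have hadd : ∀ A B hA hB, Disjoint A B →
      ∀ hAB, l (indS (Ω := Ω) (A ∪ B) hAB) = l (indS A hA) + l (indS B hB) := by
    intro A B hA hB hd hAB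
    rw [← map_add]
    congr 1
    apply Subtype.ext
    simp only [indS, Submodule.coe_add]
    exact Set.indicator_union_of_disjoint hd _
  have hempty : l (indS (Ω := Ω) ∅ MeasurableSet.empty) = 0 := by
    have : indS (Ω := Ω) ∅ MeasurableSet.empty = 0 := by
      apply Subtype.ext; simp [indS]; rfl
    rw [this, map_zero]
  let η : Measure Ω := Measure.ofMeasurable (fun A hA => ENNReal.ofReal (l (indS A hA)))
    (by simp [hempty])
    (by
      intro A hA hd
      have hfin : ∀ n, ∃ h, l (indS (⋃ i ∈ Finset.range n, A i) h) =
          ∑ i ∈ Finset.range n, l (indS (A i) (hA i)) := by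
        intro n
        induction n with
        | zero =>
          refine ⟨by simp, ?_⟩
          simp only [Finset.range_zero, Finset.sum_empty]
          rw [← hempty]; congr 2; simp
        | succ n ih =>
          obtain ⟨h, ih⟩ := ih
          have e : (⋃ i ∈ Finset.range (n+1), A i) = (⋃ i ∈ Finset.range n, A i) ∪ A n := by
            rw [Finset.range_add_one, Finset.set_biUnion_insert, union_comm]
          have h' : MeasurableSet ((⋃ i ∈ Finset.range n, A i) ∪ A n) := h.union (hA n)
          refine ⟨by rw [e]; exact h', ?_⟩
          rw [Finset.sum_range_succ, ← ih, ← hadd _ _ h (hA n) _ h']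
          · congr 2
          · rw [Set.disjoint_iUnion₂_left]
            intro i hi
            exact hd (Finset.mem_range.1 hi).ne
      set U := ⋃ i, A i
      have hU : MeasurableSet U := MeasurableSet.iUnion hA
      set B : ℕ → Set Ω := fun n => U \ ⋃ i ∈ Finset.range n, A i with hBdef
      have hB : ∀ n, MeasurableSet (B n) := fun n => hU.diff (hfin n).1
      have hsplit : ∀ n, l (indS U hU) = ∑ i ∈ Finset.range n, l (indS (A i) (hA i))
          + l (indS (B n) (hB n)) := by
        intro n
        obtain ⟨h, e⟩ := hfin n
        have hsub : (⋃ i ∈ Finset.range n, A i) ⊆ U :=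
          Set.iUnion₂_subset fun i _ => Set.subset_iUnion A i
        have hu : (⋃ i ∈ Finset.range n, A i) ∪ B n = U := Set.union_sdiff_cancel hsub
        rw [← e, ← hadd _ _ h (hB n) Set.disjoint_sdiff_right (by rw [hu]; exact hU)]
        congr 2
        exact hu.symm
      have hPB : Tendsto (fun n => P.real (B n)) atTop (𝓝 0) := by
        have hanti : Antitone B := by
          intro m n hmn
          apply Set.sdiff_subset_sdiff_right
          exact Set.biUnion_subset_biUnion_left (fun i hi => by
            simp at hi ⊢; omega)
        have := tendsto_measure_iInter_atTop (μ := P) (fun n => (hB n).nullMeasurableSet) hanti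
          ⟨0, measure_ne_top _ _⟩
        have he : ⋂ n, B n = ∅ := by
          ext x
          simp only [hBdef, mem_iInter, Set.mem_sdiff, mem_empty_iff_false, iff_false]
          intro hx
          obtain ⟨i, hi⟩ := mem_iUnion.1 (hx 0).1
          exact (hx (i+1)).2 (mem_iUnion₂.2 ⟨i, by simp, hi⟩)
        rw [he, measure_empty] at this
        exact (ENNReal.tendsto_toReal ENNReal.zero_ne_top).comp this
      have hS : HasSum (fun i => l (indS (A i) (hA i))) (l (indS U hU)) := by
        rw [hasSum_iff_tendsto_nat_of_nonneg (fun i => hind0 _ _)]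
        have h1 := (htend B hB hPB).const_sub (l (indS U hU))
        rw [sub_zero] at h1
        refine h1.congr fun n => ?_
        rw [hsplit n]; ring
      rw [← ENNReal.ofReal_tsum_of_nonneg (fun i => hind0 _ _) hS.summable, hS.tsum_eq])
  have hη : ∀ A (hA : MeasurableSet A), η A = ENNReal.ofReal (l (indS A hA)) := fun A hA =>
    Measure.ofMeasurable_apply A hA
  have hprob : IsProbabilityMeasure η := ⟨by rw [hη _ MeasurableSet.univ, hl1]; simp⟩
  refine ⟨η, hprob, ?_, ?_⟩
  · refine Measure.AbsolutelyContinuous.mk fun A hA hPA => ?_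
    rw [hη A hA]
    have := htend (fun _ => A) (fun _ => hA) (by simp [Measure.real, hPA])
    have := tendsto_nhds_unique this tendsto_const_nhds
    rw [← this]; simp
  · -- simple functions
    have hsimp : ∀ s : SimpleFunc Ω ℝ, ∃ h : (s : Ω → ℝ) ∈ Mb Ω,
        l ⟨s, h⟩ = ∫ x, s x ∂η := by
      intro s
      induction s using SimpleFunc.induction with
      | const a hA =>
        rename_i A
        have e : (SimpleFunc.piecewise A hA (SimpleFunc.const Ω a) (SimpleFunc.const Ω 0) : Ω → ℝ)
            = (a • indS A hA : MbS Ω).1 := by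
          ext x
          by_cases h : x ∈ A <;> simp [indS, h]
        have hmem : (SimpleFunc.piecewise A hA (SimpleFunc.const Ω a) (SimpleFunc.const Ω 0) :
            Ω → ℝ) ∈ MbS Ω := by rw [e]; exact Subtype.prop _
        refine ⟨hmem, ?_⟩
        have e2 : (⟨_, hmem⟩ : MbS Ω) = a • indS A hA := Subtype.ext e
        rw [e2, e, map_smul]
        have : ∫ x, (a • indS A hA : MbS Ω).1 x ∂η = a * ∫ x, A.indicator (fun _ => 1) x ∂η :=
          integral_const_mul a _
        rw [this, integral_indicator_const _ hA, Measure.real, hη A hA,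
          ENNReal.toReal_ofReal (hind0 _ _)]
        simp
      | add hd hs ht =>
        rename_i s t
        obtain ⟨hs, es⟩ := hs
        obtain ⟨ht, et⟩ := ht
        refine ⟨(MbS Ω).add_mem hs ht, ?_⟩
        have : (⟨_, (MbS Ω).add_mem hs ht⟩ : MbS Ω) = ⟨s, hs⟩ + ⟨t, ht⟩ := rfl
        have e3 : ∫ x, (s + t) x ∂η = _ :=
          integral_add (integrable_of_mb η hs) (integrable_of_mb η ht)
        rw [e3, ← es, ← et, ← map_add]
        rfl
    intro g
    obtain ⟨gm, C, hC⟩ := g.2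
    have happ : ∀ n : ℕ, |l g - ∫ x, g.1 x ∂η| ≤ 2 / ((n : ℝ) + 1) := by
      intro n
      have hn : (0 : ℝ) < (n : ℝ) + 1 := by positivity
      let s : SimpleFunc Ω ℝ :=
        { toFun := fun x => (⌊g.1 x * (n + 1)⌋ : ℝ) / (n + 1)
          measurableSet_fiber' := fun y => by
            have : Measurable (fun x => (⌊g.1 x * (n + 1)⌋ : ℝ) / (n + 1)) :=
              ((measurable_from_top (f := fun z : ℤ => (z : ℝ))).comp
                (gm.mul_const _).floor).div_const _
            exact this (measurableSet_singleton y)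
          finite_range' := by
            have : (Set.range fun x => (⌊g.1 x * (n + 1)⌋ : ℝ) / (n + 1)) ⊆
                (fun z : ℤ => (z : ℝ) / (n + 1)) '' Icc ⌊-C * (n + 1)⌋ ⌊C * (n + 1)⌋ := by
              rintro _ ⟨x, rfl⟩
              have := abs_le.1 (hC x)
              exact ⟨⌊g.1 x * (n + 1)⌋, ⟨Int.floor_le_floor (by nlinarith),
                Int.floor_le_floor (by nlinarith)⟩, rfl⟩
            exact ((Set.finite_Icc _ _).image _).subset this }
      obtain ⟨hs, es⟩ := hsimp s
      have hs1 : ∀ x, s x ≤ g.1 x := fun x => by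
        show (⌊g.1 x * (n + 1)⌋ : ℝ) / (n + 1) ≤ _
        rw [div_le_iff₀ hn]; exact Int.floor_le _
      have hs2 : ∀ x, g.1 x ≤ s x + 1 / ((n : ℝ) + 1) := fun x => by
        show _ ≤ (⌊g.1 x * (n + 1)⌋ : ℝ) / (n + 1) + _
        rw [← add_div, le_div_iff₀ hn]; exact (Int.lt_floor_add_one _).le
      have a1 : l ⟨s, hs⟩ ≤ l g := hmono _ _ hs1
      have a2 : l g ≤ l (⟨s, hs⟩ + (1 / ((n : ℝ) + 1)) • indS univ MeasurableSet.univ) :=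
        hmono _ _ (fun x => by
          refine (hs2 x).trans (le_of_eq ?_)
          simp [indS])
      rw [map_add, map_smul, hl1, smul_eq_mul, mul_one] at a2
      have b1 : ∫ x, s x ∂η ≤ ∫ x, g.1 x ∂η :=
        integral_mono (integrable_of_mb η hs) (integrable_of_mb η g.2) hs1
      have b2 : ∫ x, g.1 x ∂η ≤ ∫ x, (s x + 1 / ((n : ℝ) + 1)) ∂η :=
        integral_mono (integrable_of_mb η g.2)
          ((integrable_of_mb η hs).add (integrable_const _)) hs2
      rw [integral_add (integrable_of_mb η hs) (integrable_const _)] at b2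
      simp only [integral_const, probReal_univ, smul_eq_mul, one_mul] at b2
      have e2 : 2 / ((n : ℝ) + 1) = 1 / ((n : ℝ) + 1) + 1 / ((n : ℝ) + 1) := by ring
      have : 0 < 1 / ((n : ℝ) + 1) := by positivity
      rw [abs_le, e2]
      constructor <;> linarith
    have hlim : Tendsto (fun n : ℕ => 2 / ((n : ℝ) + 1)) atTop (𝓝 0) := by
      have := (tendsto_one_div_add_atTop_nhds_zero_nat (𝕜 := ℝ)).const_mul 2
      simpa [mul_div_assoc, div_eq_mul_inv] using this
    have := ge_of_tendsto' hlim happ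
    have := abs_nonpos_iff.1 this
    linarith

/-- Membership in the cone generated by `Γ` and the constants. -/
def InCone {S : Type*} (Γ : Set (S → ℝ)) (v : S → ℝ) : Prop :=
  ∃ L : ℝ, 0 < L ∧ ∃ g ∈ Γ, ∃ ν : ℝ, ∀ x, v x = L * g x - ν

theorem InCone.add {S : Type*} {Γ : Set (S → ℝ)} (hΓ : Convex ℝ Γ) {v w : S → ℝ}
    (hv : InCone Γ v) (hw : InCone Γ w) : InCone Γ (v + w) := by
  obtain ⟨L, hL, g, hg, ν, e⟩ := hv
  obtain ⟨L', hL', g', hg', ν', e'⟩ := hw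
  refine ⟨L + L', by positivity, (L / (L + L')) • g + (L' / (L + L')) • g',
    hΓ hg hg' (by positivity) (by positivity) (by field_simp), ν + ν', fun x => ?_⟩
  simp only [Pi.add_apply, Pi.smul_apply, smul_eq_mul, e, e']
  field_simp
  ring

theorem InCone.smul {S : Type*} {Γ : Set (S → ℝ)} {v : S → ℝ}
    (hv : InCone Γ v) {a : ℝ} (ha : 0 < a) : InCone Γ (a • v) := by
  obtain ⟨L, hL, g, hg, ν, e⟩ := hv
  refine ⟨a * L, by positivity, g, hg, a * ν, fun x => ?_⟩
  simp only [Pi.smul_apply, smul_eq_mul, e]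
  ring

theorem InCone.const {S : Type*} {Γ : Set (S → ℝ)} (h0 : (fun _ => (0 : ℝ)) ∈ Γ) (a : ℝ) :
    InCone Γ (fun _ => a) := ⟨1, one_pos, _, h0, -a, fun x => by simp⟩

/-- The lineality space of the cone. -/
def linSpace {S : Type*} (Γ : Set (S → ℝ)) (h0 : (fun _ => (0 : ℝ)) ∈ Γ) (hΓ : Convex ℝ Γ) :
    Submodule ℝ (S → ℝ) where
  carrier := {v | InCone Γ v ∧ InCone Γ (-v)}
  zero_mem' := ⟨InCone.const h0 0, by rw [neg_zero]; exact InCone.const h0 0⟩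
  add_mem' := by
    rintro v w ⟨h1, h2⟩ ⟨h3, h4⟩
    refine ⟨h1.add hΓ h3, ?_⟩
    rw [neg_add]; exact h2.add hΓ h4
  smul_mem' := by
    rintro a v ⟨h1, h2⟩
    rcases lt_trichotomy a 0 with ha | ha | ha
    · refine ⟨?_, ?_⟩
      · have := h2.smul (neg_pos.2 ha); rwa [smul_neg, neg_smul, neg_neg] at this
      · have := h1.smul (neg_pos.2 ha); rwa [neg_smul] at this
    · subst ha
      refine ⟨?_, ?_⟩
      · rw [zero_smul]; exact InCone.const h0 0
      · rw [zero_smul, neg_zero]; exact InCone.const h0 0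
    · refine ⟨h1.smul ha, ?_⟩
      rw [← smul_neg]; exact h2.smul ha

theorem mul_mb {S : Type*} [TopologicalSpace S] [MeasurableSpace S] [BorelSpace S]
    {g : S → ℝ} (hg : g ∈ Cb S) (L : ℝ) : (fun x => L * g x) ∈ Mb S := by
  obtain ⟨hc, C, hC⟩ := hg
  refine ⟨(hc.measurable).const_mul L, |L| * C, fun x => ?_⟩
  rw [abs_mul]
  exact mul_le_mul_of_nonneg_left (hC x) (abs_nonneg L)

theorem main_lower {S : Type*} [TopologicalSpace S] [MeasurableSpace S] [BorelSpace S]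
    {f : ℝ → EReal} {φ : ℝ → ℝ} (H : PhiData f φ) (hlsc : LowerSemicontinuous f)
    (Γ : Set (S → ℝ)) (hΓ : AdmissibleGamma Γ) (hΓs : StrictlyAdmissibleGamma Γ)
    (Q P : Measure S) [IsProbabilityMeasure Q] [IsProbabilityMeasure P] (c : ℝ)
    (hc : ∀ L : ℝ, 0 < L → fGammaDiv f ((fun (g : S → ℝ) => fun x => L * g x) '' Γ) Q P ≤ c) :
    fDivE f Q P ≤ (c : EReal) := by
  obtain ⟨h0, hconv, hCb, -⟩ := hΓ
  obtain ⟨Ψ, hΨ, hdet, hpm⟩ := hΓs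
  have hcone : ∀ v, InCone Γ v → v ∈ Mb S ∧ ∫ x, v x ∂Q ≤ ∫ x, φ (v x) ∂P + c := by
    rintro v ⟨L, hL, g, hg, ν, e⟩
    have hv : v = fun x => L * g x - ν := funext e
    have hm := mul_mb (hCb hg) L
    have hm' := sub_const_mb hm ν
    subst hv
    refine ⟨hm', ?_⟩
    have h1 : ((∫ x, L * g x ∂Q : ℝ) : EReal) - LambdaF f P (fun x => L * g x) ≤ c :=
      le_trans (le_iSup₂_of_le (f := fun (g : S → ℝ)
        (_ : g ∈ ((fun (g : S → ℝ) => fun x => L * g x) '' Γ)) =>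
        (((∫ x, g x ∂Q : ℝ) : EReal) - LambdaF f P g)) (fun x => L * g x) ⟨g, hg, rfl⟩ le_rfl)
        (hc L hL)
    rw [sub_le_coe_iff] at h1
    have h2 := h1.trans (iInf_le _ ν)
    rw [H.eInt P hm', ← EReal.coe_add, EReal.coe_le_coe_iff] at h2
    rw [integral_sub (integrable_of_mb Q hm) (integrable_const _)]
    simp only [integral_const, probReal_univ, smul_eq_mul, one_mul]
    linarith
  set V := linSpace Γ h0 hconv with hVdef
  have hVmem : ∀ v, v ∈ V ↔ InCone Γ v ∧ InCone Γ (-v) := fun v => Iff.rfl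
  obtain ⟨l, hl1, hl2⟩ := H.extend Q P c V (fun g hg => (hcone g hg.1).2)
  have hone : l (indS univ MeasurableSet.univ) = 1 := by
    rw [hl1]
    · simp [indS]
    · have : (indS (Ω := S) univ MeasurableSet.univ).1 = fun _ => (1 : ℝ) := by
        ext x; simp [indS]
      rw [this, hVmem]
      exact ⟨InCone.const h0 1, InCone.const h0 (-1)⟩
  obtain ⟨η, hη, hηP, hlη⟩ := H.measure P c l hone hl2
  have hQη : Q = η := by
    apply hdet Q η inferInstance hη
    intro ψ hψ
    obtain ⟨k, ε, hε, hp, hn⟩ := hpm ψ hψ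
    have hmem : ψ ∈ V := by
      rw [hVmem]
      refine ⟨⟨ε⁻¹, by positivity, _, hp, ε⁻¹ * k, fun x => ?_⟩,
        ⟨ε⁻¹, by positivity, _, hn, ε⁻¹ * k, fun x => ?_⟩⟩
      · field_simp; ring
      · simp only [Pi.neg_apply]; field_simp; ring
    have hmb : ψ ∈ MbS S := (hcone ψ hmem.1).1
    rw [← hl1 ⟨ψ, hmb⟩ hmem, hlη]
  subst hQη
  refine H.lower hlsc Q P hηP c fun g hg => ?_
  have := hl2 ⟨g, hg⟩
  rwa [hlη] at this

/-- For admissible `f`, admissible and strictly admissible `Γ`, and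
`Γ_L = {L·g : g ∈ Γ}`: each `Γ_L` (`L > 0`) is strictly admissible and
`lim_{L→∞} D_f^{Γ_L}(Q‖P) = D_f(Q‖P)`. -/
theorem stmt12 {S : Type*} [MetricSpace S] [CompleteSpace S]
    [TopologicalSpace.SeparableSpace S] [MeasurableSpace S] [BorelSpace S]
    (a b : EReal) (f : ℝ → EReal) (hf : IsF1 a b f) (hfa : AdmissibleF f)
    (Γ : Set (S → ℝ)) (hΓ : AdmissibleGamma Γ) (hΓs : StrictlyAdmissibleGamma Γ)
    (Q P : Measure S) [IsProbabilityMeasure Q] [IsProbabilityMeasure P] :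
    (∀ L : ℝ, 0 < L →
      StrictlyAdmissibleGamma ((fun (g : S → ℝ) => fun x => L * g x) '' Γ))
    ∧ Filter.Tendsto
        (fun L : ℝ => fGammaDiv f ((fun (g : S → ℝ) => fun x => L * g x) '' Γ) Q P)
        Filter.atTop (𝓝 (fDivE f Q P)) := by
  obtain ⟨φ, H⟩ := exists_phi hf hfa
  refine ⟨?_, ?_⟩
  · intro L hL
    obtain ⟨Ψ, hΨ, hdet, hpm⟩ := hΓs
    refine ⟨Ψ, hΨ, hdet, fun ψ hψ => ?_⟩
    obtain ⟨k, ε, hε, hp, hn⟩ := hpm ψ hψ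
    refine ⟨L * k, L * ε, by positivity, ⟨_, hp, ?_⟩, ⟨_, hn, ?_⟩⟩
    · ext x; ring
    · ext x; ring
  · have hup : ∀ L : ℝ, fGammaDiv f ((fun (g : S → ℝ) => fun x => L * g x) '' Γ) Q P
        ≤ fDivE f Q P := by
      intro L
      refine iSup₂_le ?_
      rintro _ ⟨g, hg, rfl⟩
      exact H.upper hf.lsc Q P (mul_mb (hΓ.2.2.1 hg) L)
    have hmono : ∀ L M : ℝ, 0 < L → L ≤ M →
        fGammaDiv f ((fun (g : S → ℝ) => fun x => L * g x) '' Γ) Q P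
        ≤ fGammaDiv f ((fun (g : S → ℝ) => fun x => M * g x) '' Γ) Q P := by
      intro L M hL hLM
      have hM : 0 < M := hL.trans_le hLM
      refine iSup₂_le ?_
      rintro _ ⟨g, hg, rfl⟩
      have hmem : (L / M) • g ∈ Γ := by
        have := hΓ.2.1 hg hΓ.1 (show 0 ≤ L / M by positivity)
          (show 0 ≤ 1 - L / M by rw [sub_nonneg, div_le_one hM]; exact hLM) (by ring)
        have e : (L / M) • g + (1 - L / M) • (fun _ => (0 : ℝ)) = (L / M) • g := by
          ext x; simp
        rwa [e] at this
      have e : (fun x => L * g x) = (fun x => M * ((L / M) • g) x) := by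
        ext x; simp only [Pi.smul_apply, smul_eq_mul]; field_simp
      refine le_iSup₂_of_le (f := fun (g : S → ℝ)
        (_ : g ∈ ((fun (g : S → ℝ) => fun x => M * g x) '' Γ)) =>
        (((∫ x, g x ∂Q : ℝ) : EReal) - LambdaF f P g)) (fun x => L * g x)
        ⟨(L / M) • g, hmem, e.symm⟩ le_rfl
    rw [tendsto_order]
    refine ⟨fun m hm => ?_, fun m hm => Eventually.of_forall fun L => (hup L).trans_lt hm⟩
    by_contra hcon
    have hall : ∀ L : ℝ, 0 < L →
        fGammaDiv f ((fun (g : S → ℝ) => fun x => L * g x) '' Γ) Q P ≤ m := by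
      intro L hL
      by_contra hlt
      push Not at hlt
      apply hcon
      filter_upwards [eventually_ge_atTop L] with M hM
      exact hlt.trans_le (hmono L M hL hM)
    cases m with
    | top => exact not_top_lt hm
    | coe c =>
      exact absurd (main_lower H hf.lsc Γ hΓ hΓs Q P c hall) (not_le.2 hm)
    | bot =>
      have hall' : ∀ c : ℝ, fDivE f Q P ≤ (c : EReal) := fun c =>
        main_lower H hf.lsc Γ hΓ hΓs Q P c (fun L hL => (hall L hL).trans bot_le)
      have hb : fDivE f Q P = ⊥ := by
        rw [EReal.eq_bot_iff_forall_lt]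
        intro y
        refine (hall' (y - 1)).trans_lt ?_
        exact_mod_cast sub_one_lt y
      exact hm.ne' hb
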